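/- arXiv:math/0508060 — 11 statements merged into one kernel-verified Lean document; each statement's English description precedes it below -/
import Mathlib

section
/- For every x, δ and every e > 0, T_met(T_met(x, δ, e)) = (x, δ, e); that is, T_met is an involution on the set {(x, δ, e) : e > 0}. -/
/-- The Metropolis transformation on the extended state space
`(Fin n → ℝ) × (Fin n → ℝ) × ℝ`:\
`T_met (x, δ, e) = (x + w·δ, −δ, e + log (π (x + w·δ) / π x))` if
`e + log (π (x + w·δ) / π x) > 0`, and `T_met (x, δ, e) = (x, δ, e)` otherwise. -/
noncomputable def Tmet (n : ℕ) (w : ℝ) (π : (Fin n → ℝ) → ℝ) :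
    ((Fin n → ℝ) × (Fin n → ℝ) × ℝ) → ((Fin n → ℝ) × (Fin n → ℝ) × ℝ) :=
  fun p =>
    if 0 < p.2.2 + Real.log (π (p.1 + w • p.2.1) / π p.1) then
      (p.1 + w • p.2.1, -p.2.1, p.2.2 + Real.log (π (p.1 + w • p.2.1) / π p.1))
    else p

/-- For every `x`, `δ` and every `e > 0`, `T_met (T_met (x, δ, e)) = (x, δ, e)`:
`T_met` is an involution on `{(x, δ, e) : e > 0}`. -/
theorem Tmet_involution (n : ℕ) (w : ℝ) (π : (Fin n → ℝ) → ℝ)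
    (hπ : ∀ y, 0 < π y) :
    ∀ (x δ : Fin n → ℝ) (e : ℝ), 0 < e →
      Tmet n w π (Tmet n w π (x, δ, e)) = (x, δ, e) := by
  intro x δ e he
  have h1 : x + w • δ + w • (-δ) = x := by simp
  have h2 : Real.log (π x / π (x + w • δ)) = -Real.log (π (x + w • δ) / π x) := by
    rw [← Real.log_inv, inv_div]
  by_cases h : 0 < e + Real.log (π (x + w • δ) / π x)
  · have hT : Tmet n w π (x, δ, e)
        = (x + w • δ, -δ, e + Real.log (π (x + w • δ) / π x)) := by
      unfold Tmet
      exact if_pos h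
    rw [hT]
    unfold Tmet
    simp only [h1, h2, neg_neg, add_neg_cancel_right, he, if_true]
  · have hT : Tmet n w π (x, δ, e) = (x, δ, e) := by
      unfold Tmet
      exact if_neg h
    rw [hT, hT]
end

section
/- T_met maps the set {(x, δ, e) : e > 0} into itself, and the restriction of T_met to this set is a bijection of the set onto itself. -/
/-- `T_met` maps the set `{(x, δ, e) : e > 0}` into itself, and its restriction to
this set is a bijection of the set onto itself. -/
theorem Tmet_bijOn (n : ℕ) (w : ℝ) (π : (Fin n → ℝ) → ℝ)
    (hπ : ∀ y, 0 < π y) :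
    Set.MapsTo (Tmet n w π) {p | 0 < p.2.2} {p | 0 < p.2.2} ∧
    Set.BijOn (Tmet n w π) {p | 0 < p.2.2} {p | 0 < p.2.2} := by
  have hm : Set.MapsTo (Tmet n w π) {p | 0 < p.2.2} {p | 0 < p.2.2} := by
    intro p hp
    simp only [Set.mem_setOf_eq] at hp ⊢
    unfold Tmet
    split_ifs with h
    · exact h
    · exact hp
  have hinv : ∀ p ∈ {p : (Fin n → ℝ) × (Fin n → ℝ) × ℝ | 0 < p.2.2},
      Tmet n w π (Tmet n w π p) = p := by
    rintro ⟨x, d, e⟩ hp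
    simp only [Set.mem_setOf_eq] at hp
    by_cases h : 0 < e + Real.log (π (x + w • d) / π x)
    · have h1 : Tmet n w π (x, d, e)
          = (x + w • d, -d, e + Real.log (π (x + w • d) / π x)) := by
        simp only [Tmet, if_pos h]
      have hx : x + w • d + w • (-d) = x := by
        rw [smul_neg, add_neg_cancel_right]
      have he : e + Real.log (π (x + w • d) / π x) + Real.log (π x / π (x + w • d)) = e := by
        rw [Real.log_div (hπ _).ne' (hπ _).ne', Real.log_div (hπ _).ne' (hπ _).ne']
        ring
      rw [h1]
      simp only [Tmet, hx, he, if_pos hp, neg_neg]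
    · have h1 : Tmet n w π (x, d, e) = (x, d, e) := by
        simp only [Tmet, if_neg h]
      rw [h1, h1]
  exact ⟨hm, Set.InvOn.bijOn ⟨hinv, hinv⟩ hm hm⟩
end

section
/- Define the joint density π̄(x, δ, e) = π(x) · f(δ) · exp(−e) on the extended state space. Then π̄(T_met(x, δ, e)) = π̄(x, δ, e) for every (x, δ, e). -/
/-- The joint density `π̄ (x, δ, e) = π x · f δ · exp (−e)` on the extended state
space is invariant under `T_met`: `π̄ (T_met (x, δ, e)) = π̄ (x, δ, e)`. -/
theorem Tmet_preserves_density (n : ℕ) (w : ℝ) (π f : (Fin n → ℝ) → ℝ)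
    (hπ : ∀ y, 0 < π y) (hf : ∀ δ, f (-δ) = f δ) :
    ∀ p : (Fin n → ℝ) × (Fin n → ℝ) × ℝ,
      π (Tmet n w π p).1 * f (Tmet n w π p).2.1 * Real.exp (-(Tmet n w π p).2.2) =
        π p.1 * f p.2.1 * Real.exp (-p.2.2) := by
  intro p
  unfold Tmet
  split_ifs with h
  · have h1 := hπ (p.1 + w • p.2.1)
    have h2 := hπ p.1
    simp only [hf]
    rw [neg_add, Real.exp_add, Real.exp_neg (Real.log _), Real.exp_log (div_pos h1 h2)]
    field_simp
  · rfl
end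

section
/- Suppose π is everywhere positive and differentiable. Then the map S(x, δ, e) = (x + w·δ, −δ, e + log(π(x + w·δ)/π(x))) is differentiable at every point of (Fin n → ℝ) × (Fin n → ℝ) × ℝ, and the determinant of its derivative (as a linear endomorphism of (Fin n → ℝ) × (Fin n → ℝ) × ℝ) has absolute value 1 at every point. -/
theorem abs_det_of_involutive {V : Type*} [AddCommGroup V] [Module ℝ V] (f : V →ₗ[ℝ] V)
    (hf : f ∘ₗ f = LinearMap.id) : |LinearMap.det f| = 1 := by
  have h : LinearMap.det f * LinearMap.det f = 1 := by
    rw [← LinearMap.det_comp, hf, LinearMap.det_id]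
  rcases mul_self_eq_one_iff.mp h with h | h <;> simp [h]

theorem abs_det_shear {E : Type*} [AddCommGroup E] [Module ℝ E] (w : ℝ)
    (a : E × E →ₗ[ℝ] ℝ) (L : E × E × ℝ →ₗ[ℝ] E × E × ℝ)
    (hL : ∀ q, L q = (q.1 + w • q.2.1, -q.2.1, q.2.2 + a (q.1, q.2.1))) :
    |LinearMap.det L| = 1 := by
  let x : E × E × ℝ →ₗ[ℝ] E := LinearMap.fst ℝ _ _
  let d : E × E × ℝ →ₗ[ℝ] E := LinearMap.fst ℝ _ _ ∘ₗ LinearMap.snd ℝ _ _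
  let t : E × E × ℝ →ₗ[ℝ] ℝ := LinearMap.snd ℝ _ _ ∘ₗ LinearMap.snd ℝ _ _
  let P : E × E × ℝ →ₗ[ℝ] E × E × ℝ := (x + w • d).prod ((-d).prod (-t))
  let Q : E × E × ℝ →ₗ[ℝ] E × E × ℝ := x.prod (d.prod (-t - a ∘ₗ (x.prod d)))
  have hPa : ∀ q, P q = (q.1 + w • q.2.1, -q.2.1, -q.2.2) := fun q => rfl
  have hQa : ∀ q, Q q = (q.1, q.2.1, -q.2.2 - a (q.1, q.2.1)) := fun q => rfl
  have hP : P ∘ₗ P = LinearMap.id := by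
    refine LinearMap.ext fun q => ?_
    rw [LinearMap.comp_apply, hPa, hPa]
    simp
  have hQ : Q ∘ₗ Q = LinearMap.id := by
    refine LinearMap.ext fun q => ?_
    rw [LinearMap.comp_apply, hQa, hQa]
    simp
  have hPQ : L = P ∘ₗ Q := by
    refine LinearMap.ext fun q => ?_
    rw [LinearMap.comp_apply, hPa, hQa, hL]
    simp [add_comm]
  rw [hPQ, LinearMap.det_comp, abs_mul, abs_det_of_involutive P hP, abs_det_of_involutive Q hQ,
    one_mul]

/-- If `π` is everywhere positive and differentiable, then the map
`S (x, δ, e) = (x + w·δ, −δ, e + log (π (x + w·δ) / π x))` is differentiable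
everywhere, and the determinant of its derivative has absolute value `1` at
every point. -/
theorem metropolis_shear_differentiable_absDet_eq_one (n : ℕ) (w : ℝ)
    (π : (Fin n → ℝ) → ℝ) (hπ : ∀ y, 0 < π y) (hdiff : Differentiable ℝ π) :
    Differentiable ℝ
      (fun p : (Fin n → ℝ) × (Fin n → ℝ) × ℝ =>
        ((p.1 + w • p.2.1, -p.2.1,
          p.2.2 + Real.log (π (p.1 + w • p.2.1) / π p.1)) :
            (Fin n → ℝ) × (Fin n → ℝ) × ℝ)) ∧
    ∀ p : (Fin n → ℝ) × (Fin n → ℝ) × ℝ,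
      |LinearMap.det
        ((fderiv ℝ
          (fun p : (Fin n → ℝ) × (Fin n → ℝ) × ℝ =>
            ((p.1 + w • p.2.1, -p.2.1,
              p.2.2 + Real.log (π (p.1 + w • p.2.1) / π p.1)) :
                (Fin n → ℝ) × (Fin n → ℝ) × ℝ)) p).toLinearMap)| = 1 := by
  have hG : Differentiable ℝ (fun q : (Fin n → ℝ) × (Fin n → ℝ) =>
      Real.log (π (q.1 + w • q.2) / π q.1)) := by
    have h1 : Differentiable ℝ (fun q : (Fin n → ℝ) × (Fin n → ℝ) => π (q.1 + w • q.2)) :=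
      hdiff.comp (by fun_prop)
    have h2 : Differentiable ℝ (fun q : (Fin n → ℝ) × (Fin n → ℝ) => π q.1) :=
      hdiff.comp (by fun_prop)
    have h3 : Differentiable ℝ (fun q : (Fin n → ℝ) × (Fin n → ℝ) =>
        π (q.1 + w • q.2) / π q.1) := by
      simp only [div_eq_mul_inv]
      exact h1.mul (h2.inv fun q => (hπ _).ne')
    exact h3.log fun q => (div_pos (hπ _) (hπ _)).ne'
  have key := fun p : (Fin n → ℝ) × (Fin n → ℝ) × ℝ =>
    have hx := hasFDerivAt_fst (𝕜 := ℝ) (p := p)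
    have hd := (hasFDerivAt_snd (𝕜 := ℝ) (p := p)).fst
    have ht := (hasFDerivAt_snd (𝕜 := ℝ) (p := p)).snd
    have hg := (hG (p.1, p.2.1)).hasFDerivAt.comp p (hx.prodMk hd)
    (hx.add (hd.const_smul w)).prodMk (hd.neg.prodMk (ht.add hg))
  refine ⟨fun p => (key p).differentiableAt, fun p => ?_⟩
  refine abs_det_shear w (fderiv ℝ (fun q : (Fin n → ℝ) × (Fin n → ℝ) =>
      Real.log (π (q.1 + w • q.2) / π q.1)) (p.1, p.2.1)).toLinearMap _ fun q => ?_
  have := (key p).fderiv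
  exact DFunLike.congr_fun this q
end

section
/- Suppose π is everywhere positive and measurable. Then T_met is a measure-preserving transformation of the restriction of Lebesgue measure (on (Fin n → ℝ) × (Fin n → ℝ) × ℝ) to the set {(x, δ, e) : e > 0}. -/
open MeasureTheory

theorem S_mp (n : ℕ) (w : ℝ) (g : (Fin n → ℝ) × (Fin n → ℝ) → ℝ) (hg : Measurable g) :
    MeasurePreserving (fun p : (Fin n → ℝ) × (Fin n → ℝ) × ℝ =>
      (p.1 + w • p.2.1, -p.2.1, p.2.2 + g (p.1, p.2.1))) volume volume := by
  have h1 : MeasurePreserving (fun q : (Fin n → ℝ) × (Fin n → ℝ) => (-q.1, q.2 + w • q.1))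
      (volume.prod volume) (volume.prod volume) := by
    refine MeasurePreserving.skew_product (f := fun d : Fin n → ℝ => -d)
      (g := fun d x => x + w • d) (Measure.measurePreserving_neg volume) ?_ ?_
    · simp only [Function.uncurry_def]
      fun_prop
    · exact Filter.Eventually.of_forall fun d => map_add_right_eq_self volume (w • d)
  have h2 : MeasurePreserving (fun q : (Fin n → ℝ) × (Fin n → ℝ) => (q.1 + w • q.2, -q.2))
      (volume.prod volume) (volume.prod volume) :=
    (Measure.measurePreserving_swap.comp h1).comp Measure.measurePreserving_swap
  have h3 : MeasurePreserving (fun r : ((Fin n → ℝ) × (Fin n → ℝ)) × ℝ =>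
      ((r.1.1 + w • r.1.2, -r.1.2), r.2 + g r.1))
      ((volume.prod volume).prod volume) ((volume.prod volume).prod volume) := by
    refine MeasurePreserving.skew_product (g := fun q e => e + g q) h2 ?_ ?_
    · simp only [Function.uncurry_def]
      fun_prop
    · exact Filter.Eventually.of_forall fun d => map_add_right_eq_self volume (g d)
  have ha := volume_preserving_prodAssoc (α₁ := Fin n → ℝ) (β₁ := Fin n → ℝ) (γ₁ := ℝ)
  exact (ha.comp h3).comp (ha.symm _)

/-- If `π` is everywhere positive and measurable, then `T_met` is a
measure-preserving transformation of the restriction of Lebesgue measure to the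
set `{(x, δ, e) : e > 0}`. -/
theorem Tmet_measurePreserving_restrict (n : ℕ) (w : ℝ)
    (π : (Fin n → ℝ) → ℝ) (hπ : ∀ y, 0 < π y) (hmeas : Measurable π) :
    MeasurePreserving (Tmet n w π)
      (volume.restrict {p : (Fin n → ℝ) × (Fin n → ℝ) × ℝ | 0 < p.2.2})
      (volume.restrict {p : (Fin n → ℝ) × (Fin n → ℝ) × ℝ | 0 < p.2.2}) := by
  set g : (Fin n → ℝ) × (Fin n → ℝ) → ℝ :=
    fun q => Real.log (π (q.1 + w • q.2) / π q.1) with hgdef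
  have hg : Measurable g := by
    have h1 : Measurable fun q : (Fin n → ℝ) × (Fin n → ℝ) => π (q.1 + w • q.2) :=
      hmeas.comp (by fun_prop)
    have h2 : Measurable fun q : (Fin n → ℝ) × (Fin n → ℝ) => π q.1 :=
      hmeas.comp measurable_fst
    exact Real.measurable_log.comp (h1.div h2)
  have hS := S_mp n w g hg
  set S := (fun p : (Fin n → ℝ) × (Fin n → ℝ) × ℝ =>
      (p.1 + w • p.2.1, -p.2.1, p.2.2 + g (p.1, p.2.1))) with hSdef
  set E := {p : (Fin n → ℝ) × (Fin n → ℝ) × ℝ | 0 < p.2.2} with hE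
  have hEm : MeasurableSet E := measurableSet_lt measurable_const (by fun_prop)
  have hinv : ∀ p, S (S p) = p := by
    rintro ⟨x, d, e⟩
    have hx : x + w • d + w • -d = x := by simp
    simp only [hSdef, hgdef, hx, neg_neg]
    rw [Real.log_div (hπ _).ne' (hπ _).ne', Real.log_div (hπ _).ne' (hπ _).ne']
    congr 2
    ring
  have hAm : MeasurableSet (S ⁻¹' E) := hS.measurable hEm
  have hT : ∀ p, p ∈ S ⁻¹' E → Tmet n w π p = S p := fun p hp => if_pos hp
  have hT' : ∀ p, p ∉ S ⁻¹' E → Tmet n w π p = p := fun p hp => if_neg hp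
  have hTm : Measurable (Tmet n w π) := by
    classical
    have : Tmet n w π = (S ⁻¹' E).piecewise S id := by
      funext p
      by_cases hp : p ∈ S ⁻¹' E
      · rw [hT p hp, Set.piecewise_eq_of_mem _ _ _ hp]
      · rw [hT' p hp, Set.piecewise_eq_of_notMem _ _ _ hp]; rfl
    rw [this]
    exact Measurable.piecewise hAm hS.measurable measurable_id
  refine ⟨hTm, ?_⟩
  ext B hB
  rw [Measure.map_apply hTm hB, Measure.restrict_apply (hTm hB), Measure.restrict_apply hB,
    ← measure_inter_add_diff (Tmet n w π ⁻¹' B ∩ E) hAm, ← measure_inter_add_diff (B ∩ E) hAm]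
  congr 1
  · rw [← hS.measure_preimage ((hB.inter hEm).inter hAm).nullMeasurableSet]
    congr 1
    ext p
    simp only [Set.mem_inter_iff, Set.mem_preimage, hinv]
    constructor
    · rintro ⟨⟨h1, h2⟩, h3⟩
      rw [hT p h3] at h1
      exact ⟨⟨h1, h3⟩, h2⟩
    · rintro ⟨⟨h1, h2⟩, h3⟩
      refine ⟨⟨?_, h3⟩, h2⟩
      rwa [hT p h2]
  · congr 1
    ext p
    simp only [Set.mem_inter_iff, Set.mem_sdiff]
    refine and_congr_left fun h => ?_
    rw [Set.mem_preimage, hT' p h]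
end

section
/- Suppose π is everywhere positive and measurable, and f is nonnegative and measurable with f(−δ) = f(δ) for all δ. Let μ be the measure on (Fin n → ℝ) × (Fin n → ℝ) × ℝ whose density with respect to Lebesgue measure is π(x) · f(δ) · exp(−e) on the set {e > 0} and 0 elsewhere. Then T_met is a measure-preserving transformation of μ. -/
open MeasureTheory

noncomputable def Smet (n : ℕ) (w : ℝ) (π : (Fin n → ℝ) → ℝ) :
    ((Fin n → ℝ) × (Fin n → ℝ) × ℝ) → ((Fin n → ℝ) × (Fin n → ℝ) × ℝ) :=
  fun p => (p.1 + w • p.2.1, -p.2.1, p.2.2 + Real.log (π (p.1 + w • p.2.1) / π p.1))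

theorem Smet_mp (n : ℕ) (w : ℝ) (π : (Fin n → ℝ) → ℝ) (hπm : Measurable π) :
    MeasurePreserving (Smet n w π) volume volume := by
  have h2 : MeasurePreserving (fun p : (Fin n → ℝ) × (Fin n → ℝ) × ℝ =>
      (p.1, (p.2.1, p.2.2 + Real.log (π (p.1 + w • p.2.1) / π p.1)))) volume volume := by
    refine (MeasurePreserving.id volume).skew_product
      (g := fun x (q : (Fin n → ℝ) × ℝ) =>
        (q.1, q.2 + Real.log (π (x + w • q.1) / π x))) ?_ ?_
    · unfold Function.uncurry
      fun_prop
    · refine Filter.Eventually.of_forall fun x => ?_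
      refine ((MeasurePreserving.id volume).skew_product
        (g := fun d (e : ℝ) => e + Real.log (π (x + w • d) / π x)) ?_ ?_).map_eq
      · unfold Function.uncurry
        fun_prop
      · exact Filter.Eventually.of_forall fun d => (measurePreserving_add_right volume _).map_eq
  have h1 : MeasurePreserving (fun p : ((Fin n → ℝ) × ℝ) × (Fin n → ℝ) =>
      ((-p.1.1, p.1.2), p.2 + w • p.1.1)) volume volume := by
    refine MeasurePreserving.skew_product (f := fun q : (Fin n → ℝ) × ℝ => (-q.1, q.2))
      (g := fun (q : (Fin n → ℝ) × ℝ) x => x + w • q.1) ?_ ?_ ?_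
    · exact (Measure.measurePreserving_neg volume).prod (MeasurePreserving.id volume)
    · unfold Function.uncurry
      fun_prop
    · exact Filter.Eventually.of_forall fun d => (measurePreserving_add_right volume _).map_eq
  exact (Measure.measurePreserving_swap.comp (h1.comp Measure.measurePreserving_swap)).comp h2

/-- If `π` is everywhere positive and measurable, `f` is nonnegative, measurable and
symmetric, and `μ` is the measure with density `π x · f δ · exp (−e)` on `{e > 0}`
(and `0` elsewhere) with respect to Lebesgue measure, then `T_met` is a
measure-preserving transformation of `μ`. -/
theorem Tmet_measurePreserving_density (n : ℕ) (w : ℝ)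
    (π f : (Fin n → ℝ) → ℝ) (hπ : ∀ y, 0 < π y) (hπm : Measurable π)
    (hf0 : ∀ δ, 0 ≤ f δ) (hfm : Measurable f) (hfsymm : ∀ δ, f (-δ) = f δ) :
    MeasurePreserving (Tmet n w π)
      (volume.withDensity (fun p : (Fin n → ℝ) × (Fin n → ℝ) × ℝ =>
        if 0 < p.2.2 then ENNReal.ofReal (π p.1 * f p.2.1 * Real.exp (-p.2.2)) else 0))
      (volume.withDensity (fun p : (Fin n → ℝ) × (Fin n → ℝ) × ℝ =>
        if 0 < p.2.2 then ENNReal.ofReal (π p.1 * f p.2.1 * Real.exp (-p.2.2)) else 0)) := by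
  classical
  have hS := Smet_mp n w π hπm
  have hSm := hS.measurable
  set S := Smet n w π with hSdef
  have hSS : ∀ p, S (S p) = p := by
    rintro ⟨x, d, e⟩
    have h1 : x + w • d + w • -d = x := by simp
    simp only [hSdef, Smet, h1, neg_neg]
    rw [Real.log_div (hπ _).ne' (hπ _).ne', Real.log_div (hπ _).ne' (hπ _).ne']
    simp
    ring
  have hT : ∀ p, Tmet n w π p = if 0 < (S p).2.2 then S p else p := fun p => rfl
  have hTm : Measurable (Tmet n w π) := by
    have : Tmet n w π = fun p => if 0 < (S p).2.2 then S p else p := funext hT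
    rw [this]
    exact Measurable.ite (measurableSet_lt measurable_const (by fun_prop)) hSm measurable_id
  set G : (Fin n → ℝ) × (Fin n → ℝ) × ℝ → ENNReal :=
    fun p => ENNReal.ofReal (π p.1 * f p.2.1 * Real.exp (-p.2.2)) with hG
  have hGm : Measurable G := by
    rw [hG]
    fun_prop
  have hGS : ∀ p, G (S p) = G p := by
    rintro ⟨x, d, e⟩
    simp only [hSdef, Smet, hG, hfsymm]
    congr 1
    have := hπ x
    have := hπ (x + w • d)
    rw [neg_add, Real.exp_add, Real.exp_neg (Real.log _), Real.exp_log (by positivity)]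
    field_simp
  have hpos : MeasurableSet {p : (Fin n → ℝ) × (Fin n → ℝ) × ℝ | 0 < p.2.2} :=
    measurableSet_lt measurable_const (by fun_prop)
  have hposS : MeasurableSet {p : (Fin n → ℝ) × (Fin n → ℝ) × ℝ | 0 < (S p).2.2} :=
    measurableSet_lt measurable_const (by fun_prop)
  refine ⟨hTm, ?_⟩
  ext s hs
  rw [Measure.map_apply hTm hs, withDensity_apply _ (hTm hs), withDensity_apply _ hs,
    ← lintegral_indicator (hTm hs), ← lintegral_indicator hs]
  let A : (Fin n → ℝ) × (Fin n → ℝ) × ℝ → ENNReal := fun p =>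
    if 0 < p.2.2 then if 0 < (S p).2.2 then if p ∈ s then G p else 0 else 0 else 0
  let B : (Fin n → ℝ) × (Fin n → ℝ) × ℝ → ENNReal := fun p =>
    if 0 < p.2.2 then if 0 < (S p).2.2 then 0 else if p ∈ s then G p else 0 else 0
  have hA : Measurable A :=
    Measurable.ite hpos (Measurable.ite hposS (Measurable.ite hs hGm measurable_const)
      measurable_const) measurable_const
  have e1 : ∀ p, (Tmet n w π ⁻¹' s).indicator (fun p => if 0 < p.2.2 then G p else 0) p
      = A (S p) + B p := by
    intro p
    simp only [Set.indicator, Set.mem_preimage, hT, A, B, hSS, hGS]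
    split_ifs <;> simp_all
  have e2 : ∀ p, s.indicator (fun p => if 0 < p.2.2 then G p else 0) p = A p + B p := by
    intro p
    simp only [Set.indicator, A, B]
    split_ifs <;> simp_all
  calc _ = ∫⁻ p, A (S p) + B p := lintegral_congr e1
    _ = (∫⁻ p, A (S p)) + ∫⁻ p, B p := lintegral_add_left (hA.comp hSm) _
    _ = (∫⁻ p, A p) + ∫⁻ p, B p := by rw [hS.lintegral_comp hA]
    _ = ∫⁻ p, A p + B p := (lintegral_add_left hA _).symm
    _ = _ := (lintegral_congr e2).symm
end

section
/- Let μ be a measure on a measurable space α, let T : α → α be a measurable map with T(T(z)) = z for all z that is measure-preserving for μ, and let A be a measurable subset of α. Then the modified transformation T̃ is measurable and measure-preserving for μ. -/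
open MeasureTheory

open Classical in
/-- Given a map `T : α → α` and a set `A ⊆ α`, the modified transformation `T̃` is
defined by `T̃ z = z` if `z ∈ A` or `T z ∈ A`, and `T̃ z = T z` otherwise. -/
noncomputable def modT {α : Type*} (T : α → α) (A : Set α) : α → α :=
  fun z => if z ∈ A ∨ T z ∈ A then z else T z

/-- If `T` is a measurable involution that is measure-preserving for `μ`, and `A`
is a measurable set, then the modified transformation `T̃` is measurable and
measure-preserving for `μ`. -/
theorem modT_measurePreserving {α : Type*} [MeasurableSpace α]
    (μ : Measure α) (T : α → α) (hTmeas : Measurable T)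
    (hTinv : ∀ z, T (T z) = z) (hT : MeasurePreserving T μ μ)
    (A : Set α) (hA : MeasurableSet A) :
    Measurable (modT T A) ∧ MeasurePreserving (modT T A) μ μ := by
  classical
  have hB : MeasurableSet (A ∪ T ⁻¹' A) := hA.union (hTmeas hA)
  have hm : Measurable (modT T A) := Measurable.ite hB measurable_id hTmeas
  refine ⟨hm, hm, ?_⟩
  ext s hs
  rw [Measure.map_apply hm hs, ← measure_inter_add_diff (modT T A ⁻¹' s) hB,
    ← measure_inter_add_diff s hB]
  have h1 : modT T A ⁻¹' s ∩ (A ∪ T ⁻¹' A) = s ∩ (A ∪ T ⁻¹' A) := by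
    ext z
    by_cases h : z ∈ A ∨ T z ∈ A <;> simp [modT, h]
  have h2 : modT T A ⁻¹' s \ (A ∪ T ⁻¹' A) = T ⁻¹' (s \ (A ∪ T ⁻¹' A)) := by
    ext z
    by_cases h : z ∈ A ∨ T z ∈ A
    · simp only [modT, Set.mem_sdiff, Set.mem_preimage, Set.mem_union, hTinv]
      tauto
    · simp only [modT, Set.mem_sdiff, Set.mem_preimage, Set.mem_union, hTinv, if_neg h]
      tauto
  rw [h1, h2, hT.measure_preimage (hs.diff hB).nullMeasurableSet]
end

section
/- Let π : (Fin n → ℝ) → ℝ be everywhere positive and measurable, and let f : (Fin n → ℝ) → ℝ be nonnegative and measurable with f(−δ) = f(δ) for all δ and ∫ f dλ = 1, where λ is Lebesgue measure on (Fin n → ℝ). Then the random-walk Metropolis update leaves the measure with density π invariant: for every measurable set S ⊆ (Fin n → ℝ), ∫∫ π(x) · f(δ) · [ min(1, π(x+δ)/π(x)) · 1_S(x+δ) + (1 − min(1, π(x+δ)/π(x))) · 1_S(x) ] dδ dx = ∫_S π dλ. -/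
open MeasureTheory

/-- The random-walk Metropolis update leaves the measure with density `π` invariant:
for every measurable set `S`,
`∫∫ π x · f δ · [min 1 (π (x+δ)/π x) · 1_S (x+δ) + (1 − min 1 (π (x+δ)/π x)) · 1_S x] dδ dx
  = ∫_S π dλ`. -/
theorem metropolis_update_leaves_pi_invariant (n : ℕ)
    (π f : (Fin n → ℝ) → ℝ) (hπ : ∀ y, 0 < π y) (hπm : Measurable π)
    (hf0 : ∀ δ, 0 ≤ f δ) (hfm : Measurable f) (hfsymm : ∀ δ, f (-δ) = f δ)
    (hfint : ∫⁻ δ, ENNReal.ofReal (f δ) ∂(volume : Measure (Fin n → ℝ)) = 1) :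
    ∀ S : Set (Fin n → ℝ), MeasurableSet S →
      ∫⁻ x, ∫⁻ δ,
        ENNReal.ofReal (π x * f δ *
          (min 1 (π (x + δ) / π x) * S.indicator (fun _ => (1 : ℝ)) (x + δ) +
           (1 - min 1 (π (x + δ) / π x)) * S.indicator (fun _ => (1 : ℝ)) x))
        ∂(volume : Measure (Fin n → ℝ)) ∂(volume : Measure (Fin n → ℝ)) =
      ∫⁻ x in S, ENNReal.ofReal (π x) ∂(volume : Measure (Fin n → ℝ)) := by
  intro S hS
  have hI : Measurable (S.indicator (fun _ => (1 : ℝ))) := measurable_const.indicator hS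
  have hI0 : ∀ x, 0 ≤ S.indicator (fun _ => (1 : ℝ)) x :=
    fun x => Set.indicator_nonneg (fun _ _ => zero_le_one) x
  have hIm : ∀ x, ENNReal.ofReal (π x * S.indicator (fun _ => (1 : ℝ)) x)
      = S.indicator (fun x => ENNReal.ofReal (π x)) x := by
    intro x
    by_cases hx : x ∈ S <;> simp [hx]
  generalize S.indicator (fun _ => (1 : ℝ)) = I at hI hI0 hIm
  have hmin : ∀ x y, π x * min 1 (π y / π x) = min (π x) (π y) := by
    intro x y
    rw [mul_min_of_nonneg _ _ (hπ x).le, mul_one, mul_div_cancel₀ _ (hπ x).ne']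
  have hm0 : ∀ x y, 0 ≤ min (π x) (π y) := fun x y => le_min (hπ x).le (hπ y).le
  have hsplit : ∀ x δ, ENNReal.ofReal (π x * f δ *
          (min 1 (π (x + δ) / π x) * I (x + δ) + (1 - min 1 (π (x + δ) / π x)) * I x))
      = ENNReal.ofReal (f δ * min (π x) (π (x + δ)) * I (x + δ))
        + ENNReal.ofReal (f δ * (π x - min (π x) (π (x + δ))) * I x) := by
    intro x δ
    rw [← ENNReal.ofReal_add]
    · congr 1
      rw [← hmin]
      ring
    · exact mul_nonneg (mul_nonneg (hf0 _) (hm0 _ _)) (hI0 _)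
    · exact mul_nonneg (mul_nonneg (hf0 _) (sub_nonneg.2 (min_le_left _ _))) (hI0 _)
  have hjoin : ∀ x δ, ENNReal.ofReal (f δ * min (π x) (π (x + δ)) * I x)
        + ENNReal.ofReal (f δ * (π x - min (π x) (π (x + δ))) * I x)
      = ENNReal.ofReal (f δ) * ENNReal.ofReal (π x * I x) := by
    intro x δ
    rw [← ENNReal.ofReal_add, ← ENNReal.ofReal_mul (hf0 _)]
    · congr 1
      ring
    · exact mul_nonneg (mul_nonneg (hf0 _) (hm0 _ _)) (hI0 _)
    · exact mul_nonneg (mul_nonneg (hf0 _) (sub_nonneg.2 (min_le_left _ _))) (hI0 _)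
  have hA : Measurable (fun p : (Fin n → ℝ) × (Fin n → ℝ) =>
      ENNReal.ofReal (f p.2 * min (π p.1) (π (p.1 + p.2)) * I (p.1 + p.2))) := by fun_prop
  have hB : Measurable (fun p : (Fin n → ℝ) × (Fin n → ℝ) =>
      ENNReal.ofReal (f p.2 * min (π p.1) (π (p.1 + p.2)) * I p.1)) := by fun_prop
  have hAB : ∫⁻ x, ∫⁻ δ, ENNReal.ofReal (f δ * min (π x) (π (x + δ)) * I (x + δ))
        ∂(volume : Measure (Fin n → ℝ)) ∂(volume : Measure (Fin n → ℝ))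
      = ∫⁻ x, ∫⁻ δ, ENNReal.ofReal (f δ * min (π x) (π (x + δ)) * I x)
        ∂(volume : Measure (Fin n → ℝ)) ∂(volume : Measure (Fin n → ℝ)) := by
    refine (lintegral_lintegral_swap hA.aemeasurable).trans
      (Eq.trans ?_ (lintegral_lintegral_swap hB.aemeasurable).symm)
    rw [← lintegral_neg_eq_self]
    refine lintegral_congr fun δ => ?_
    rw [← lintegral_add_right_eq_self _ δ]
    refine lintegral_congr fun x => ?_
    rw [hfsymm, add_neg_cancel_right, min_comm]
  simp_rw [hsplit]
  have h1 : ∀ x, ∫⁻ δ, (ENNReal.ofReal (f δ * min (π x) (π (x + δ)) * I (x + δ))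
        + ENNReal.ofReal (f δ * (π x - min (π x) (π (x + δ))) * I x))
        ∂(volume : Measure (Fin n → ℝ)) = _ := fun x =>
    lintegral_add_left (hA.comp measurable_prodMk_left) _
  have h2 : ∀ x, ∫⁻ δ, (ENNReal.ofReal (f δ * min (π x) (π (x + δ)) * I x)
        + ENNReal.ofReal (f δ * (π x - min (π x) (π (x + δ))) * I x))
        ∂(volume : Measure (Fin n → ℝ)) = _ := fun x =>
    lintegral_add_left (hB.comp measurable_prodMk_left) _
  rw [lintegral_congr h1]
  refine (lintegral_add_left hA.lintegral_prod_right' _).trans ?_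
  refine (congrArg (· + _) hAB).trans ?_
  refine (lintegral_add_left hB.lintegral_prod_right' _).symm.trans ?_
  refine (lintegral_congr h2).symm.trans ?_
  simp_rw [hjoin]
  rw [← lintegral_indicator hS]
  refine lintegral_congr fun x => ?_
  rw [lintegral_mul_const _ hfm.ennreal_ofReal, hfint, one_mul, hIm]
end

section
/- Let π : (Fin n → ℝ) → ℝ be everywhere positive and measurable, let f : (Fin n → ℝ) → ℝ be nonnegative and measurable with f(−δ) = f(δ) for all δ and ∫ f dλ = 1, and let w : ℝ. Define Φ(x, δ, e) = x + w·δ if e + log(π(x + w·δ)/π(x)) > 0, and Φ(x, δ, e) = x otherwise. Then the pushforward under Φ of the product measure (λ.withDensity π) ⊗ (λ.withDensity f) ⊗ Exp(1) equals λ.withDensity π, where Exp(1) is the exponential distribution of rate 1 on ℝ. -/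
open MeasureTheory ProbabilityTheory


lemma exp_acc (a b : ℝ) (ha : 0 < a) (hb : 0 < b) :
    ENNReal.ofReal a * expMeasure 1 {e : ℝ | 0 < e + Real.log (b / a)}
      = min (ENNReal.ofReal a) (ENNReal.ofReal b) := by
  have : IsProbabilityMeasure (expMeasure 1) := isProbabilityMeasure_expMeasure one_pos
  have hset : {e : ℝ | 0 < e + Real.log (b / a)} = (Set.Iic (-Real.log (b / a)))ᶜ := by
    ext e
    simp only [Set.mem_ofPred_eq, Set.mem_compl_iff, Set.mem_Iic, not_le]
    constructor <;> intro h <;> linarith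
  have hba : 0 < b / a := div_pos hb ha
  rw [hset, prob_compl_eq_one_sub measurableSet_Iic, ← ofReal_cdf, cdf_expMeasure_eq one_pos,
    ← ENNReal.ofReal_one, ← ENNReal.ofReal_min]
  split_ifs with h
  · have hle : b / a ≤ 1 := by
      by_contra hc
      have := Real.log_pos (not_le.mp hc)
      linarith
    have hle2 : b ≤ a := (div_le_one ha).mp hle
    rw [one_mul, neg_neg, Real.exp_log hba, ← ENNReal.ofReal_sub _ (by linarith),
      ← ENNReal.ofReal_mul ha.le, min_eq_right hle2]
    congr 1
    field_simp
    ring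
  · have h1 : 1 ≤ b / a := by
      by_contra hc
      have := Real.log_neg hba (not_le.mp hc)
      linarith
    rw [min_eq_left ((one_le_div ha).mp h1)]
    simp

/-- One Metropolis update realized with auxiliary variables: pushing forward
`(λ.withDensity π) ⊗ (λ.withDensity f) ⊗ Exp(1)` under the map
`Φ (x, δ, e) = x + w·δ` if `e + log (π (x + w·δ) / π x) > 0`, else `x`,
yields `λ.withDensity π` again. -/
theorem metropolis_pushforward_invariant (n : ℕ) (w : ℝ)
    (π f : (Fin n → ℝ) → ℝ) (hπ : ∀ y, 0 < π y) (hπm : Measurable π)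
    (hf0 : ∀ δ, 0 ≤ f δ) (hfm : Measurable f) (hfsymm : ∀ δ, f (-δ) = f δ)
    (hfint : ∫⁻ δ, ENNReal.ofReal (f δ) ∂(volume : Measure (Fin n → ℝ)) = 1) :
    Measure.map
      (fun p : (Fin n → ℝ) × (Fin n → ℝ) × ℝ =>
        if 0 < p.2.2 + Real.log (π (p.1 + w • p.2.1) / π p.1) then
          p.1 + w • p.2.1
        else p.1)
      (((volume : Measure (Fin n → ℝ)).withDensity (fun x => ENNReal.ofReal (π x))).prod
        ((((volume : Measure (Fin n → ℝ)).withDensity (fun δ => ENNReal.ofReal (f δ))).prod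
          (expMeasure 1)))) =
    (volume : Measure (Fin n → ℝ)).withDensity (fun x => ENNReal.ofReal (π x)) := by
  have : IsProbabilityMeasure (expMeasure 1) := isProbabilityMeasure_expMeasure one_pos
  have hP : Measurable fun x => ENNReal.ofReal (π x) := hπm.ennreal_ofReal
  have hF : Measurable fun x => ENNReal.ofReal (f x) := hfm.ennreal_ofReal
  have hS : MeasurableSet {p : (Fin n → ℝ) × (Fin n → ℝ) × ℝ |
      0 < p.2.2 + Real.log (π (p.1 + w • p.2.1) / π p.1)} := by
    apply measurableSet_lt <;> fun_prop
  have hΦ : Measurable (fun p : (Fin n → ℝ) × (Fin n → ℝ) × ℝ =>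
        if 0 < p.2.2 + Real.log (π (p.1 + w • p.2.1) / π p.1) then
          p.1 + w • p.2.1
        else p.1) := Measurable.ite hS (by fun_prop) (by fun_prop)
  have : IsProbabilityMeasure
      ((volume : Measure (Fin n → ℝ)).withDensity (fun δ => ENNReal.ofReal (f δ))) :=
    ⟨by rw [withDensity_apply _ MeasurableSet.univ, Measure.restrict_univ, hfint]⟩
  refine Measure.ext_of_lintegral _ fun g hg => ?_
  have hgΦ : Measurable (fun p : (Fin n → ℝ) × (Fin n → ℝ) × ℝ =>
      g (if 0 < p.2.2 + Real.log (π (p.1 + w • p.2.1) / π p.1) then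
          p.1 + w • p.2.1
        else p.1)) := hg.comp hΦ
  rw [lintegral_map hg hΦ, lintegral_prod _ hgΦ.aemeasurable,
    lintegral_withDensity_eq_lintegral_mul _ hP hgΦ.lintegral_prod_right',
    lintegral_withDensity_eq_lintegral_mul _ hP hg]
  set m : (Fin n → ℝ) → (Fin n → ℝ) → ENNReal :=
    fun x y => min (ENNReal.ofReal (π x)) (ENNReal.ofReal (π y)) with hm
  have hstep : ∀ x δ, ENNReal.ofReal (π x) *
      ∫⁻ e, g (if 0 < e + Real.log (π (x + w • δ) / π x) then x + w • δ else x) ∂(expMeasure 1)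
      = m x (x + w • δ) * g (x + w • δ) + (ENNReal.ofReal (π x) - m x (x + w • δ)) * g x := by
    intro x δ
    set S := {e : ℝ | 0 < e + Real.log (π (x + w • δ) / π x)} with hSd
    have hSm : MeasurableSet S := by
      apply measurableSet_lt <;> fun_prop
    have hacc : ENNReal.ofReal (π x) * expMeasure 1 S = m x (x + w • δ) :=
      exp_acc _ _ (hπ _) (hπ _)
    have e1 : ∫⁻ e in S, g (if 0 < e + Real.log (π (x + w • δ) / π x) then x + w • δ else x)
        ∂(expMeasure 1) = ∫⁻ e in S, g (x + w • δ) ∂(expMeasure 1) :=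
      setLIntegral_congr_fun hSm fun e he => by
        have he' : 0 < e + Real.log (π (x + w • δ) / π x) := he
        simp only [if_pos he']
    have e2 : ∫⁻ e in Sᶜ, g (if 0 < e + Real.log (π (x + w • δ) / π x) then x + w • δ else x)
        ∂(expMeasure 1) = ∫⁻ e in Sᶜ, g x ∂(expMeasure 1) :=
      setLIntegral_congr_fun hSm.compl fun e he => by
        have he' : ¬ 0 < e + Real.log (π (x + w • δ) / π x) := he
        simp only [if_neg he']
    rw [← lintegral_add_compl _ hSm, e1, e2,
      setLIntegral_const, setLIntegral_const, prob_compl_eq_one_sub hSm, ← hacc, mul_add,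
      mul_comm (g x), mul_comm (g (x + w • δ)), ← mul_assoc, ← mul_assoc,
      ENNReal.mul_sub (fun _ _ => ENNReal.ofReal_ne_top), mul_one]
  have hinner : ∀ x, ENNReal.ofReal (π x) * ∫⁻ q : (Fin n → ℝ) × ℝ,
      g (if 0 < q.2 + Real.log (π (x + w • q.1) / π x) then x + w • q.1 else x)
        ∂(((volume : Measure (Fin n → ℝ)).withDensity (fun δ => ENNReal.ofReal (f δ))).prod
          (expMeasure 1))
      = (∫⁻ δ, ENNReal.ofReal (f δ) * (m x (x + w • δ) * g (x + w • δ)))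
        + ∫⁻ δ, ENNReal.ofReal (f δ) * ((ENNReal.ofReal (π x) - m x (x + w • δ)) * g x) := by
    intro x
    have hx : Measurable fun q : (Fin n → ℝ) × ℝ =>
      g (if 0 < q.2 + Real.log (π (x + w • q.1) / π x) then x + w • q.1 else x) :=
      hgΦ.comp (measurable_prodMk_left (x := x))
    rw [lintegral_prod _ hx.aemeasurable,
      lintegral_withDensity_eq_lintegral_mul _ hF hx.lintegral_prod_right',
      ← lintegral_const_mul _ (hF.mul hx.lintegral_prod_right'), ← lintegral_add_left (by fun_prop)]
    refine lintegral_congr fun δ => ?_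
    rw [← mul_add, ← hstep]
    simp only [Pi.mul_apply]
    ring
  have hsum : ∀ x, (∫⁻ δ, ENNReal.ofReal (f δ) * (m x (x + w • δ) * g x))
        + (∫⁻ δ, ENNReal.ofReal (f δ) * ((ENNReal.ofReal (π x) - m x (x + w • δ)) * g x))
      = ENNReal.ofReal (π x) * g x := by
    intro x
    rw [← lintegral_add_left (by fun_prop)]
    have : ∀ δ, ENNReal.ofReal (f δ) * (m x (x + w • δ) * g x) +
        ENNReal.ofReal (f δ) * ((ENNReal.ofReal (π x) - m x (x + w • δ)) * g x)
        = ENNReal.ofReal (f δ) * (ENNReal.ofReal (π x) * g x) := by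
      intro δ
      rw [← mul_add, ← add_mul, add_tsub_cancel_of_le (min_le_left _ _)]
    simp_rw [this]
    rw [lintegral_mul_const _ hF, hfint, one_mul]
  have hswap : (∫⁻ x, ∫⁻ δ, ENNReal.ofReal (f δ) * (m x (x + w • δ) * g (x + w • δ)))
      = ∫⁻ x, ∫⁻ δ, ENNReal.ofReal (f δ) * (m x (x + w • δ) * g x) := by
    refine (lintegral_lintegral_swap (by fun_prop)).trans
      (Eq.trans ?_ (lintegral_lintegral_swap (by fun_prop)).symm)
    rw [← lintegral_neg_eq_self]
    refine lintegral_congr fun δ => ?_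
    rw [← lintegral_add_right_eq_self _ (w • δ)]
    refine lintegral_congr fun x => ?_
    simp only [smul_neg, add_neg_cancel_right, hfsymm, hm]
    rw [min_comm]
  calc _ = ∫⁻ x, ((∫⁻ δ, ENNReal.ofReal (f δ) * (m x (x + w • δ) * g (x + w • δ)))
        + ∫⁻ δ, ENNReal.ofReal (f δ) * ((ENNReal.ofReal (π x) - m x (x + w • δ)) * g x)) :=
        lintegral_congr fun x => hinner x
    _ = ∫⁻ x, ((∫⁻ δ, ENNReal.ofReal (f δ) * (m x (x + w • δ) * g x))
        + ∫⁻ δ, ENNReal.ofReal (f δ) * ((ENNReal.ofReal (π x) - m x (x + w • δ)) * g x)) := by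
        rw [lintegral_add_left, hswap, ← lintegral_add_left]
        · exact Measurable.lintegral_prod_right (by fun_prop)
        · exact Measurable.lintegral_prod_right (by fun_prop)
    _ = _ := lintegral_congr fun x => hsum x
end

section
/- Let α be a type, let K ≥ 1 and L ≥ 1 be natural numbers, and let F : ZMod K → (α → α) be a family of maps each of which is an involution (F_j(F_j(x)) = x for all j and x). For s ∈ {−1, +1} and i ∈ ZMod K, define G(x, i, s) = (F_{i+(L−1)s}( ⋯ F_{i+s}(F_i(x)) ⋯ ), i + (L−1)s, −s), i.e., apply F at the indices i, i+s, …, i+(L−1)s in order, move the index to i+(L−1)s, and negate the direction s. Then G is an involution: G(G(x, i, s)) = (x, i, s) for all x, i, s. -/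
/-- `fwd F i s j` applies the maps `F` at the indices `i, i + s, …, i + (j−1)·s`
in order: `fwd F i s 0 = id` and `fwd F i s (j+1) x = F (i + j·s) (fwd F i s j x)`. -/
def fwd {α : Type*} {K : ℕ} (F : ZMod K → α → α) (i s : ZMod K) : ℕ → α → α
  | 0 => id
  | j + 1 => fun x => F (i + (j : ZMod K) * s) (fwd F i s j x)

/-- The group transformation `T_seq` of the short-cut Metropolis method:
apply `F` at the indices `i, i + s, …, i + (L−1)·s` in order, move the index to
`i + (L−1)·s`, and negate the direction `s`. -/
def Tseq {α : Type*} {K : ℕ} (F : ZMod K → α → α) (L : ℕ) :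
    α × ZMod K × ZMod K → α × ZMod K × ZMod K :=
  fun p => (fwd F p.2.1 p.2.2 L p.1, p.2.1 + ((L - 1 : ℕ) : ZMod K) * p.2.2, -p.2.2)

theorem fwd_succ_front {α : Type*} {K : ℕ} (F : ZMod K → α → α) (i s : ZMod K) (n : ℕ) (x : α) :
    fwd F i s (n + 1) x = fwd F (i + s) s n (F i x) := by
  induction n with
  | zero => simp [fwd]
  | succ n ih =>
    have h1 : fwd F i s (n + 1 + 1) x
        = F (i + ((n + 1 : ℕ) : ZMod K) * s) (fwd F i s (n + 1) x) := rfl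
    have h2 : fwd F (i + s) s (n + 1) (F i x)
        = F (i + s + (n : ZMod K) * s) (fwd F (i + s) s n (F i x)) := rfl
    rw [h1, h2, ih]
    congr 1
    push_cast
    ring

theorem fwd_reverse {α : Type*} {K : ℕ} (F : ZMod K → α → α) (hF : ∀ j z, F j (F j z) = z)
    (i s : ZMod K) (n : ℕ) (x : α) :
    fwd F (i + (n : ZMod K) * s - s) (-s) n (fwd F i s n x) = x := by
  induction n with
  | zero => rfl
  | succ n ih =>
    have h1 : fwd F i s (n + 1) x = F (i + (n : ZMod K) * s) (fwd F i s n x) := rfl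
    have h2 : i + ((n + 1 : ℕ) : ZMod K) * s - s = i + (n : ZMod K) * s := by
      push_cast
      ring
    rw [fwd_succ_front, h1, h2, hF, ← sub_eq_add_neg, ih]

/-- If every `F j` is an involution, then the group transformation `T_seq` is an
involution: `G (G (x, i, s)) = (x, i, s)` for all `x`, `i` and `s ∈ {−1, +1}`. -/
theorem Tseq_involution {α : Type*} (K L : ℕ) (hK : 1 ≤ K) (hL : 1 ≤ L)
    (F : ZMod K → α → α) (hF : ∀ j z, F j (F j z) = z) :
    ∀ (x : α) (i s : ZMod K), s = 1 ∨ s = -1 →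
      Tseq F L (Tseq F L (x, i, s)) = (x, i, s) := by
  intro x i s _
  obtain ⟨n, rfl⟩ : ∃ n, L = n + 1 := ⟨L - 1, by omega⟩
  have h := fwd_reverse F hF i s (n + 1) x
  have h2 : i + ((n + 1 : ℕ) : ZMod K) * s - s = i + (n : ZMod K) * s := by
    push_cast
    ring
  rw [h2] at h
  simp only [Tseq, Nat.add_sub_cancel, h, neg_neg]
  congr 2
  ring
end

section
/- Let α be a type, let K ≥ 1 and L ≥ 1 be natural numbers, let F : ZMod K → (α → α) be a family of involutions, let s ∈ {−1, +1} and i ∈ ZMod K. Define the forward states x_0 = x and x_{j+1} = F_{i+j·s}(x_j) for 0 ≤ j < L, and the reverse states y_0 = x_L and y_{j+1} = F_{i+(L−1−j)·s}(y_j) for 0 ≤ j < L. Then y_j = x_{L−j} for all 0 ≤ j ≤ L; consequently, the j-th reverse update is a rejection (y_{j+1} = y_j) if and only if the (L−1−j)-th forward update was a rejection (x_{L−j} = x_{L−1−j}), and in particular the number of rejections in the reverse pass equals the number of rejections in the forward pass. -/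
/-- Reversing a group of `L` updates by involutions `F_j` retraces the forward states:
if `x 0, x 1, …, x L` are the forward states (`x (j+1) = F (i + j·s) (x j)`) and
`y 0, y 1, …, y L` are the reverse states starting from `y 0 = x L`
(`y (j+1) = F (i + (L−1−j)·s) (y j)`), then `y j = x (L − j)` for all `j ≤ L`;
consequently, the `j`-th reverse update is a rejection iff the `(L−1−j)`-th forward
update was a rejection, and the number of rejections in the reverse pass equals
the number of rejections in the forward pass. -/
theorem reverse_pass_rejections {α : Type*} [DecidableEq α]
    (K L : ℕ) (hK : 1 ≤ K) (hL : 1 ≤ L)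
    (F : ZMod K → α → α) (hF : ∀ j z, F j (F j z) = z)
    (s : ZMod K) (hs : s = 1 ∨ s = -1) (i : ZMod K)
    (x y : ℕ → α)
    (hx : ∀ j < L, x (j + 1) = F (i + (j : ZMod K) * s) (x j))
    (hy0 : y 0 = x L)
    (hy : ∀ j < L, y (j + 1) = F (i + ((L - 1 - j : ℕ) : ZMod K) * s) (y j)) :
    (∀ j ≤ L, y j = x (L - j)) ∧
    (∀ j < L, (y (j + 1) = y j ↔ x (L - j) = x (L - 1 - j))) ∧
    ((Finset.range L).filter (fun j => y (j + 1) = y j)).card =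
      ((Finset.range L).filter (fun j => x (j + 1) = x j)).card := by
  have h1 : ∀ j ≤ L, y j = x (L - j) := by
    intro j
    induction j with
    | zero => intro _; simpa using hy0
    | succ j ih =>
      intro hj
      have e : L - j = (L - 1 - j) + 1 := by omega
      have e2 : L - (j + 1) = L - 1 - j := by omega
      rw [hy j (by omega), ih (by omega), e, hx (L - 1 - j) (by omega), hF, e2]
  have h2 : ∀ j < L, (y (j + 1) = y j ↔ x (L - j) = x (L - 1 - j)) := by
    intro j hj
    have e2 : L - (j + 1) = L - 1 - j := by omega
    rw [h1 (j + 1) (by omega), h1 j (by omega), e2]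
    exact eq_comm
  refine ⟨h1, h2, ?_⟩
  refine Finset.card_bij' (fun j _ => L - 1 - j) (fun j _ => L - 1 - j) ?_ ?_ ?_ ?_
  · intro j hj
    simp only [Finset.mem_filter, Finset.mem_range] at hj ⊢
    have e : L - 1 - j + 1 = L - j := by omega
    refine ⟨by omega, ?_⟩
    rw [e]
    exact (h2 j hj.1).1 hj.2
  · intro j hj
    simp only [Finset.mem_filter, Finset.mem_range] at hj ⊢
    refine ⟨by omega, ?_⟩
    rw [h2 (L - 1 - j) (by omega)]
    have e : L - (L - 1 - j) = j + 1 := by omega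
    have e2 : L - 1 - (L - 1 - j) = j := by omega
    rw [e, e2]
    exact hj.2
  · intro j hj
    simp only [Finset.mem_filter, Finset.mem_range] at hj
    omega
  · intro j hj
    simp only [Finset.mem_filter, Finset.mem_range] at hj
    omega
end
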